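/- Let n ∈ ℕ, fix x₀ ∈ ℝ^n with ‖x₀‖ = 1, and for each m ∈ ℕ let A be an m×n Gaussian random matrix. Let 0 < α < 1 and 0 < ε ≤ min(1, (1 − √α)/(4α)). If 0 < β ≤ (1 − √α)ε/(16 ln(4/((1 − √α)ε))), then P(Ω_{ε,β}) ≥ 1 − 3e^{−α(ε²/4 − ε³/6)m} for every m ∈ ℕ. Consequently, β^max_{ε,α} > ((1 − √α)/32)·ε/ln(1/ε) for every 0 < ε ≤ (1 − √α)/4. -/

import Mathlib

open MeasureTheory ProbabilityTheory Real

/-- The law of an `m × n` Gaussian random matrix with i.i.d. `N(0,1)` entries. -/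
noncomputable def gaussianMatrix (m n : ℕ) : Measure (Fin m → Fin n → ℝ) :=
  Measure.pi fun _ => Measure.pi fun _ => gaussianReal 0 1

/-- `‖A_T x‖²`. -/
noncomputable def subNormSq {m n : ℕ} (A : Fin m → Fin n → ℝ) (x : Fin n → ℝ)
    (T : Finset (Fin m)) : ℝ :=
  ∑ i ∈ T, (∑ j, A i j * x j) ^ 2

/-- The event `Ω_{ε,β}`. -/
def omegaEvent (m n : ℕ) (x₀ : Fin n → ℝ) (ε β : ℝ) : Set (Fin m → Fin n → ℝ) :=
  {A | ∀ T : Finset (Fin m), (Tᶜ.card : ℝ) ≤ β * m →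
    |(1 / (T.card : ℝ)) * subNormSq A x₀ T - 1| ≤ ε}

/-- `β^max_{ε,α}` (with `sSup ∅ = 0` in `ℝ`). -/
noncomputable def betaMax (n : ℕ) (x₀ : Fin n → ℝ) (ε α : ℝ) : ℝ :=
  sSup {β : ℝ | 0 ≤ β ∧ β < 1 ∧ ∀ m : ℕ, 0 < m →
    ENNReal.ofReal (1 - 3 * Real.exp (-α * (ε ^ 2 / 4 - ε ^ 3 / 6) * m)) ≤
      gaussianMatrix m n (omegaEvent m n x₀ ε β)}

/-- A linear combination of i.i.d. standard Gaussians with unit coefficient vector is standard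
Gaussian. -/
theorem map_sum_mul_pi_gaussianReal {n : ℕ} (x : Fin n → ℝ) (hx : ∑ j, x j ^ 2 = 1) :
    (Measure.pi fun _ : Fin n => gaussianReal 0 1).map (fun r => ∑ j, r j * x j) =
      gaussianReal 0 1 := by
  have hmeas : Measurable fun r : Fin n → ℝ => ∑ j, r j * x j := by fun_prop
  have := Measure.isProbabilityMeasure_map (μ := Measure.pi fun _ : Fin n => gaussianReal 0 1)
    hmeas.aemeasurable
  refine Measure.ext_of_charFun (funext fun t => ?_)
  rw [charFun_apply_real, integral_map hmeas.aemeasurable (by fun_prop)]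
  have hfac : ∀ r : Fin n → ℝ,
      Complex.exp (t * (∑ j, r j * x j : ℝ) * Complex.I) =
        ∏ j, Complex.exp ((t * x j : ℝ) * (r j : ℂ) * Complex.I) := by
    intro r
    rw [← Complex.exp_sum]
    congr 1
    push_cast
    rw [Finset.mul_sum, Finset.sum_mul]
    exact Finset.sum_congr rfl fun j _ => by ring
  simp_rw [hfac]
  rw [integral_fintype_prod_eq_prod
    (f := fun j (y : ℝ) => Complex.exp ((t * x j : ℝ) * (y : ℂ) * Complex.I))]
  simp_rw [← charFun_apply_real, charFun_gaussianReal]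
  rw [← Complex.exp_sum]
  congr 1
  have hx' : ∑ j, (x j : ℂ) ^ 2 = 1 := by exact_mod_cast hx
  simp only [Complex.ofReal_zero, mul_zero, zero_mul, zero_sub, NNReal.coe_one,
    Complex.ofReal_one, one_mul, Complex.ofReal_mul, mul_pow]
  rw [Finset.sum_neg_distrib, ← Finset.sum_div, ← Finset.mul_sum, hx', mul_one]

/-- The moment generating function of the square of a standard Gaussian. -/
theorem lintegral_exp_mul_sq_gaussianReal {t : ℝ} (ht : t < 1 / 2) :
    ∫⁻ x, ENNReal.ofReal (exp (t * x ^ 2)) ∂gaussianReal 0 1 =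
      ENNReal.ofReal (√(1 - 2 * t))⁻¹ := by
  have hpos : 0 < 1 - 2 * t := by linarith
  obtain ⟨v, hvcoe⟩ : ∃ v : NNReal, (v : ℝ) = (1 - 2 * t)⁻¹ :=
    CanLift.prf _ (inv_pos.2 hpos).le
  have hvne : v ≠ 0 := by
    rw [← NNReal.coe_ne_zero, hvcoe]
    exact (inv_pos.2 hpos).ne'
  rw [gaussianReal_of_var_ne_zero 0 one_ne_zero,
    lintegral_withDensity_eq_lintegral_mul _ (measurable_gaussianPDF 0 1) (by fun_prop)]
  have hpt : ∀ x : ℝ, (gaussianPDF 0 1 * fun x => ENNReal.ofReal (exp (t * x ^ 2))) x =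
      ENNReal.ofReal (√(1 - 2 * t))⁻¹ * gaussianPDF 0 v x := by
    intro x
    rw [Pi.mul_apply, gaussianPDF, gaussianPDF,
      ← ENNReal.ofReal_mul (gaussianPDFReal_nonneg _ _ _),
      ← ENNReal.ofReal_mul (inv_nonneg.2 (Real.sqrt_nonneg _)), gaussianPDFReal, gaussianPDFReal,
      hvcoe, mul_assoc, ← exp_add, Real.sqrt_mul (by positivity) (1 - 2 * t)⁻¹, Real.sqrt_inv]
    have hs : √(1 - 2 * t) ≠ 0 := (Real.sqrt_pos.2 hpos).ne'
    rw [mul_inv, inv_inv]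
    have he : -(x - 0) ^ 2 / (2 * ((1 : NNReal) : ℝ)) + t * x ^ 2 =
        -(x - 0) ^ 2 / (2 * (1 - 2 * t)⁻¹) := by
      field_simp
      push_cast
      ring
    rw [he]
    simp only [NNReal.coe_one, mul_one]
    field_simp
  simp_rw [hpt]
  rw [lintegral_const_mul _ (measurable_gaussianPDF 0 v), lintegral_gaussianPDF_eq_one 0 hvne,
    mul_one]

theorem one_add_le_exp_cubic {x : ℝ} (h0 : 0 ≤ x) :
    1 + x ≤ exp (x - x ^ 2 / 2 + x ^ 3 / 3) := by
  have hmono : MonotoneOn (fun y : ℝ => y - y ^ 2 / 2 + y ^ 3 / 3 - log (1 + y))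
      (Set.Ici 0) := by
    refine monotoneOn_of_hasDerivWithinAt_nonneg (f' := fun y => y ^ 3 / (1 + y))
      (convex_Ici 0) ?_ ?_ ?_
    · refine ContinuousOn.sub (by fun_prop) (ContinuousOn.log (by fun_prop) ?_)
      intro y hy
      have : 0 ≤ y := hy
      positivity
    · intro y hy
      rw [interior_Ici] at hy
      have hy0 : 0 < y := hy
      have hd := ((((hasDerivAt_id y).sub (((hasDerivAt_id y).pow 2).div_const 2)).add
        (((hasDerivAt_id y).pow 3).div_const 3)).sub
        (((hasDerivAt_id y).const_add 1).log (by positivity))).hasDerivWithinAt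
        (s := interior (Set.Ici 0))
      refine hd.congr_deriv ?_
      simp
      field_simp
      ring
    · intro y hy
      rw [interior_Ici] at hy
      have hy0 : 0 < y := hy
      positivity
  have h := hmono (Set.mem_Ici.2 le_rfl) (Set.mem_Ici.2 h0) h0
  norm_num at h
  rw [← Real.log_le_iff_le_exp (by linarith)]
  linarith

theorem one_sub_le_exp_quadratic {x : ℝ} (h0 : 0 ≤ x) (h1 : x < 1) :
    1 - x ≤ exp (-x - x ^ 2 / 2) := by
  have hs := hasSum_pow_div_log_of_abs_lt_one (abs_lt.2 ⟨by linarith, h1⟩ : |x| < 1)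
  have h := sum_le_hasSum (Finset.range 2) (fun i _ => by positivity) hs
  norm_num [Finset.sum_range_succ] at h
  rw [← Real.log_le_iff_le_exp (by linarith)]
  linarith

section Chernoff

variable {Ω : Type*} [MeasurableSpace Ω] {P : Measure Ω} {m : ℕ} {Z : Fin m → Ω → ℝ}

/-- Markov's inequality for a product of functions of i.i.d. standard Gaussians. -/
theorem measure_le_prod_le (hind : iIndepFun Z P) (hmeas : ∀ i, Measurable (Z i))
    (hlaw : ∀ i, P.map (Z i) = gaussianReal 0 1) {g : ℝ → ℝ} (hg : Measurable g)
    (hg0 : ∀ x, 0 ≤ g x) {M : ℝ} (hM : 0 ≤ M)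
    (hgM : ∫⁻ x, ENNReal.ofReal (g x) ∂gaussianReal 0 1 = ENNReal.ofReal M) {c : ℝ}
    (hc : 0 < c) :
    P {ω | c ≤ ∏ i, g (Z i ω)} ≤ ENNReal.ofReal (M ^ m / c) := by
  have hint : ∫⁻ ω, ∏ i, ENNReal.ofReal (g (Z i ω)) ∂P = ENNReal.ofReal M ^ m := by
    rw [lintegral_prod_eq_prod_lintegral_of_indepFun Finset.univ
      (fun i ω => ENNReal.ofReal (g (Z i ω)))
      (hind.comp (fun _ x => ENNReal.ofReal (g x)) fun _ => hg.ennreal_ofReal)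
      fun i => (hg.comp (hmeas i)).ennreal_ofReal]
    have hone : ∀ i, ∫⁻ ω, ENNReal.ofReal (g (Z i ω)) ∂P = ENNReal.ofReal M := fun i => by
      rw [← hgM, ← hlaw i, lintegral_map hg.ennreal_ofReal (hmeas i)]
    simp [hone]
  have hset : {ω | c ≤ ∏ i, g (Z i ω)} =
      {ω | ENNReal.ofReal c ≤ ∏ i, ENNReal.ofReal (g (Z i ω))} := by
    ext ω
    simp only [Set.mem_ofPred_eq]
    rw [← ENNReal.ofReal_prod_of_nonneg fun i _ => hg0 _,
      ENNReal.ofReal_le_ofReal_iff (Finset.prod_nonneg fun i _ => hg0 _)]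
  rw [hset, ENNReal.ofReal_div_of_pos hc, ENNReal.ofReal_pow hM, ← hint]
  exact meas_ge_le_lintegral_div
    (Finset.measurable_prod _ fun i _ => (hg.comp (hmeas i)).ennreal_ofReal).aemeasurable
    (by simpa using hc) ENNReal.ofReal_ne_top

/-- The Chernoff bound for a sum of squares of i.i.d. standard Gaussians. -/
theorem measure_exp_le_exp_sum_sq_le (hind : iIndepFun Z P) (hmeas : ∀ i, Measurable (Z i))
    (hlaw : ∀ i, P.map (Z i) = gaussianReal 0 1) {t : ℝ} (ht : t < 1 / 2) (c : ℝ) :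
    P {ω | c ≤ t * ∑ i, Z i ω ^ 2} ≤ ENNReal.ofReal ((√(1 - 2 * t))⁻¹ ^ m / exp c) := by
  have h := measure_le_prod_le hind hmeas hlaw (g := fun x => exp (t * x ^ 2)) (by fun_prop)
    (fun x => (exp_pos _).le) (by positivity) (lintegral_exp_mul_sq_gaussianReal ht) (exp_pos c)
  simpa only [← exp_sum, ← Finset.mul_sum, exp_le_exp] using h

/-- The upper chi-square tail bound. -/
theorem measure_sum_sq_ge_le (hind : iIndepFun Z P) (hmeas : ∀ i, Measurable (Z i))
    (hlaw : ∀ i, P.map (Z i) = gaussianReal 0 1) {δ : ℝ} (h0 : 0 < δ) :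
    P {ω | (1 + δ) * m ≤ ∑ i, Z i ω ^ 2} ≤
      ENNReal.ofReal (exp (-(δ ^ 2 / 4 - δ ^ 3 / 6) * m)) := by
  have hd : 0 < 1 + δ := by linarith
  have ht : δ / (2 * (1 + δ)) < 1 / 2 := by
    rw [div_lt_div_iff₀ (by positivity) two_pos]
    linarith
  have hset : {ω | (1 + δ) * m ≤ ∑ i, Z i ω ^ 2} ⊆
      {ω | δ / 2 * m ≤ δ / (2 * (1 + δ)) * ∑ i, Z i ω ^ 2} := by
    intro ω hω
    calc δ / 2 * m = δ / (2 * (1 + δ)) * ((1 + δ) * m) := by field_simp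
      _ ≤ _ := mul_le_mul_of_nonneg_left hω (by positivity)
  refine (measure_mono hset).trans ((measure_exp_le_exp_sum_sq_le hind hmeas hlaw ht _).trans
    (ENNReal.ofReal_le_ofReal ?_))
  have hbase : (√(1 - 2 * (δ / (2 * (1 + δ)))))⁻¹ ≤ exp (δ / 2 - δ ^ 2 / 4 + δ ^ 3 / 6) := by
    rw [show 1 - 2 * (δ / (2 * (1 + δ))) = (1 + δ)⁻¹ by field_simp; ring, Real.sqrt_inv, inv_inv]
    refine Real.sqrt_le_iff.2 ⟨(exp_pos _).le, ?_⟩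
    rw [← exp_nat_mul]
    convert one_add_le_exp_cubic h0.le using 2
    push_cast
    ring
  rw [div_le_iff₀ (exp_pos _), ← exp_add]
  refine (pow_le_pow_left₀ (by positivity) hbase m).trans (le_of_eq ?_)
  rw [← exp_nat_mul]
  congr 1
  ring

/-- The lower chi-square tail bound. -/
theorem measure_sum_sq_le_le (hind : iIndepFun Z P) (hmeas : ∀ i, Measurable (Z i))
    (hlaw : ∀ i, P.map (Z i) = gaussianReal 0 1) {δ : ℝ} (h0 : 0 < δ) (h1 : δ < 1) :
    P {ω | ∑ i, Z i ω ^ 2 ≤ (1 - δ) * m} ≤ ENNReal.ofReal (exp (-(δ ^ 2 / 4) * m)) := by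
  have hd : 0 < 1 - δ := by linarith
  have ht0 : 0 < δ / (2 * (1 - δ)) := by positivity
  have hset : {ω | ∑ i, Z i ω ^ 2 ≤ (1 - δ) * m} ⊆
      {ω | -(δ / 2 * m) ≤ -(δ / (2 * (1 - δ))) * ∑ i, Z i ω ^ 2} := by
    intro ω hω
    have : δ / (2 * (1 - δ)) * ∑ i, Z i ω ^ 2 ≤ δ / 2 * m :=
      calc _ ≤ δ / (2 * (1 - δ)) * ((1 - δ) * m) := mul_le_mul_of_nonneg_left hω ht0.le
        _ = _ := by field_simp
    simpa only [Set.mem_ofPred_eq, neg_mul, neg_le_neg_iff] using this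
  refine (measure_mono hset).trans ((measure_exp_le_exp_sum_sq_le hind hmeas hlaw
    (by linarith) _).trans (ENNReal.ofReal_le_ofReal ?_))
  have hbase : (√(1 - 2 * -(δ / (2 * (1 - δ)))))⁻¹ ≤ exp (-(δ / 2) - δ ^ 2 / 4) := by
    rw [show 1 - 2 * -(δ / (2 * (1 - δ))) = (1 - δ)⁻¹ by field_simp; ring, Real.sqrt_inv,
      inv_inv]
    refine Real.sqrt_le_iff.2 ⟨(exp_pos _).le, ?_⟩
    rw [← exp_nat_mul]
    convert one_sub_le_exp_quadratic h0.le h1 using 2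
    push_cast
    ring
  rw [div_le_iff₀ (exp_pos _), ← exp_add]
  refine (pow_le_pow_left₀ (by positivity) hbase m).trans (le_of_eq ?_)
  rw [← exp_nat_mul]
  congr 1
  ring

theorem exp_sum_le_mul_prod_one_add {ι : Type*} [Fintype ι] (f : ι → ℝ) (U : Finset ι) {w : ℝ}
    (hw : 0 < w) :
    exp (∑ i ∈ U, f i) * w ^ U.card ≤ ∏ i, (1 + w * exp (f i)) := by
  have hpos : ∀ i, 0 ≤ w * exp (f i) := fun i => by positivity
  calc exp (∑ i ∈ U, f i) * w ^ U.card = ∏ i ∈ U, w * exp (f i) := by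
        rw [exp_sum, Finset.prod_mul_distrib, Finset.prod_const, mul_comm]
    _ ≤ ∏ i ∈ U, (1 + w * exp (f i)) :=
        Finset.prod_le_prod (fun i _ => hpos i) fun i _ => by linarith
    _ ≤ ∏ i, (1 + w * exp (f i)) :=
        Finset.prod_le_prod_of_subset_of_one_le (Finset.subset_univ U)
          (fun i _ => by linarith [hpos i]) fun i _ _ => by linarith [hpos i]

/-- A uniform tail bound for the sums of squares over all small index sets. -/
theorem measure_exists_sum_sq_ge_le (hind : iIndepFun Z P) (hmeas : ∀ i, Measurable (Z i))
    (hlaw : ∀ i, P.map (Z i) = gaussianReal 0 1) {w : ℝ} (hw0 : 0 < w) (hw1 : w ≤ 1)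
    (β γ : ℝ) :
    P {ω | ∃ U : Finset (Fin m), (U.card : ℝ) ≤ β * m ∧ γ * m ≤ ∑ i ∈ U, Z i ω ^ 2} ≤
      ENNReal.ofReal (exp ((2 * w - β * log w - 3 / 8 * γ) * m)) := by
  have hlogw : log w ≤ 0 := Real.log_nonpos hw0.le hw1
  have hint : ∫⁻ x, ENNReal.ofReal (1 + w * exp (3 / 8 * x ^ 2)) ∂gaussianReal 0 1 =
      ENNReal.ofReal (1 + 2 * w) := by
    have hsplit : ∀ x : ℝ, ENNReal.ofReal (1 + w * exp (3 / 8 * x ^ 2)) =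
        1 + ENNReal.ofReal w * ENNReal.ofReal (exp (3 / 8 * x ^ 2)) := fun x => by
      rw [ENNReal.ofReal_add zero_le_one (by positivity), ENNReal.ofReal_one,
        ENNReal.ofReal_mul hw0.le]
    simp_rw [hsplit]
    rw [lintegral_add_left measurable_const, lintegral_const_mul _ (by fun_prop),
      lintegral_exp_mul_sq_gaussianReal (by norm_num), ← ENNReal.ofReal_mul hw0.le,
      show (1 : ℝ) - 2 * (3 / 8) = (1 / 2) ^ 2 by norm_num, Real.sqrt_sq (by norm_num),
      lintegral_const, measure_univ, mul_one, ← ENNReal.ofReal_one,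
      ← ENNReal.ofReal_add zero_le_one (by positivity)]
    norm_num [mul_comm]
  have hset : {ω | ∃ U : Finset (Fin m), (U.card : ℝ) ≤ β * m ∧ γ * m ≤ ∑ i ∈ U, Z i ω ^ 2} ⊆
      {ω | exp ((β * log w + 3 / 8 * γ) * m) ≤ ∏ i, (1 + w * exp (3 / 8 * Z i ω ^ 2))} := by
    rintro ω ⟨U, hU, hγ⟩
    refine le_trans ?_ (exp_sum_le_mul_prod_one_add (fun i => 3 / 8 * Z i ω ^ 2) U hw0)
    rw [← Real.exp_log (pow_pos hw0 _), ← exp_add, exp_le_exp, Real.log_pow, ← Finset.mul_sum]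
    linarith [mul_le_mul_of_nonpos_right hU hlogw]
  refine (measure_mono hset).trans ((measure_le_prod_le hind hmeas hlaw
    (g := fun x => 1 + w * exp (3 / 8 * x ^ 2)) (by fun_prop) (fun x => by positivity)
    (by positivity) hint (exp_pos _)).trans (ENNReal.ofReal_le_ofReal ?_))
  have hbase : 1 + 2 * w ≤ exp (2 * w) := by linarith [Real.add_one_le_exp (2 * w)]
  rw [div_le_iff₀ (exp_pos _), ← exp_add]
  refine (pow_le_pow_left₀ (by positivity) hbase m).trans (le_of_eq ?_)
  rw [← exp_nat_mul]
  congr 1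
  ring

end Chernoff

section GaussianMatrix

variable {m n : ℕ} {x₀ : Fin n → ℝ}

instance isProbabilityMeasure_gaussianMatrix (m n : ℕ) :
    IsProbabilityMeasure (gaussianMatrix m n) := by
  unfold gaussianMatrix
  infer_instance

theorem iIndepFun_gaussianMatrix_row (m n : ℕ) (x₀ : Fin n → ℝ) :
    iIndepFun (fun (i : Fin m) (A : Fin m → Fin n → ℝ) => ∑ j, A i j * x₀ j)
      (gaussianMatrix m n) :=
  iIndepFun_pi (X := fun (_ : Fin m) (r : Fin n → ℝ) => ∑ j, r j * x₀ j)
    fun _ => Measurable.aemeasurable (by fun_prop)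

theorem map_gaussianMatrix_row (hx₀ : ∑ j, x₀ j ^ 2 = 1) (i : Fin m) :
    (gaussianMatrix m n).map (fun A => ∑ j, A i j * x₀ j) = gaussianReal 0 1 := by
  have h : (fun A : Fin m → Fin n → ℝ => ∑ j, A i j * x₀ j) =
      (fun r => ∑ j, r j * x₀ j) ∘ fun A => A i := rfl
  rw [h, ← Measure.map_map (by fun_prop) (by fun_prop), gaussianMatrix,
    (measurePreserving_eval _ i).map_eq, map_sum_mul_pi_gaussianReal x₀ hx₀]

theorem omegaEvent_anti {ε β β' : ℝ} (h : β ≤ β') :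
    omegaEvent m n x₀ ε β' ⊆ omegaEvent m n x₀ ε β :=
  fun _ hA T hT => hA T (hT.trans (mul_le_mul_of_nonneg_right h (Nat.cast_nonneg m)))

theorem mem_omegaEvent_of_forall {a ε β : ℝ} (hm : 0 < m) (hε : 0 < ε) (hε1 : ε ≤ 1)
    (hβ : β * (1 + ε) ≤ (1 - a) * ε)
    {A : Fin m → Fin n → ℝ}
    (hup : ∑ i, (∑ j, A i j * x₀ j) ^ 2 < (1 + a * ε) * m)
    (hlow : (1 - a * ε) * m < ∑ i, (∑ j, A i j * x₀ j) ^ 2)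
    (hsub : ∀ U : Finset (Fin m), (U.card : ℝ) ≤ β * m →
      ∑ i ∈ U, (∑ j, A i j * x₀ j) ^ 2 < (1 - a) * ε * m) :
    A ∈ omegaEvent m n x₀ ε β := by
  intro T hT
  have hm' : (0 : ℝ) < m := Nat.cast_pos.2 hm
  have hcard : (T.card : ℝ) + (Tᶜ.card : ℝ) = m := by
    rw [← Nat.cast_add, Finset.card_add_card_compl, Fintype.card_fin]
  have hTpos : (0 : ℝ) < T.card := by nlinarith
  have hsum := Finset.sum_add_sum_compl T fun i => (∑ j, A i j * x₀ j) ^ 2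
  have hc0 : 0 ≤ ∑ i ∈ Tᶜ, (∑ j, A i j * x₀ j) ^ 2 := Finset.sum_nonneg fun i _ => sq_nonneg _
  have hc := hsub Tᶜ hT
  have hTc : (0 : ℝ) ≤ (Tᶜ.card : ℝ) := Nat.cast_nonneg _
  have hmul : (Tᶜ.card : ℝ) * (1 + ε) ≤ (1 - a) * ε * m := by nlinarith
  rw [one_div_mul_eq_div, abs_le, le_sub_iff_add_le, le_div_iff₀ hTpos, sub_le_iff_le_add,
    div_le_iff₀ hTpos, subNormSq]
  constructor <;> nlinarith

theorem le_gaussianMatrix_omegaEvent {a ε β : ℝ} (hx₀ : ∑ j, x₀ j ^ 2 = 1) (hm : 0 < m)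
    (ha0 : 0 < a) (ha1 : a < 1) (hε0 : 0 < ε) (hε1 : ε ≤ 1) (hβ0 : 0 < β) (hβ1 : β < 1)
    (hβ : β * (1 + ε) ≤ (1 - a) * ε) (haε : 4 * a ^ 2 * ε ≤ 1 - a)
    (hlog : β * (1 - log (β / 2)) ≤ 5 / 16 * ((1 - a) * ε)) :
    ENNReal.ofReal (1 - 3 * exp (-a ^ 2 * (ε ^ 2 / 4 - ε ^ 3 / 6) * m)) ≤
      gaussianMatrix m n (omegaEvent m n x₀ ε β) := by
  set μ := gaussianMatrix m n
  set p := exp (-a ^ 2 * (ε ^ 2 / 4 - ε ^ 3 / 6) * m) with hp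
  have hind := iIndepFun_gaussianMatrix_row m n x₀
  have hmeas : ∀ i : Fin m, Measurable fun A : Fin m → Fin n → ℝ => ∑ j, A i j * x₀ j :=
    fun i => by fun_prop
  have hlaw := fun i : Fin m => map_gaussianMatrix_row hx₀ i
  have hm' : (0 : ℝ) ≤ m := Nat.cast_nonneg m
  have hδ1 : a * ε < 1 := by nlinarith
  have hε3 : 0 < ε ^ 3 := pow_pos hε0 3
  have haa : 0 < a ^ 2 := pow_pos ha0 2
  have haε3 : 0 ≤ a ^ 2 * ε ^ 3 * (1 - a) := mul_nonneg (by positivity) (by linarith)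
  have haε3' : 0 ≤ a ^ 2 * ε ^ 3 := by positivity
  have h₁ : μ {A | (1 + a * ε) * m ≤ ∑ i, (∑ j, A i j * x₀ j) ^ 2} ≤ ENNReal.ofReal p := by
    refine (measure_sum_sq_ge_le hind hmeas hlaw (by positivity)).trans
      (ENNReal.ofReal_le_ofReal (exp_le_exp.2 (mul_le_mul_of_nonneg_right ?_ hm')))
    nlinarith
  have h₂ : μ {A | ∑ i, (∑ j, A i j * x₀ j) ^ 2 ≤ (1 - a * ε) * m} ≤ ENNReal.ofReal p := by
    refine (measure_sum_sq_le_le hind hmeas hlaw (by positivity) hδ1).trans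
      (ENNReal.ofReal_le_ofReal (exp_le_exp.2 (mul_le_mul_of_nonneg_right ?_ hm')))
    nlinarith
  have h₃ : μ {A | ∃ U : Finset (Fin m), (U.card : ℝ) ≤ β * m ∧
      (1 - a) * ε * m ≤ ∑ i ∈ U, (∑ j, A i j * x₀ j) ^ 2} ≤ ENNReal.ofReal p := by
    refine (measure_exists_sum_sq_ge_le hind hmeas hlaw (half_pos hβ0) (by linarith) β
      ((1 - a) * ε)).trans
      (ENNReal.ofReal_le_ofReal (exp_le_exp.2 (mul_le_mul_of_nonneg_right ?_ hm')))
    have := mul_le_mul_of_nonneg_right haε hε0.le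
    nlinarith
  have hcover : (Set.univ : Set (Fin m → Fin n → ℝ)) ⊆ omegaEvent m n x₀ ε β ∪
      ({A | (1 + a * ε) * m ≤ ∑ i, (∑ j, A i j * x₀ j) ^ 2} ∪
      ({A | ∑ i, (∑ j, A i j * x₀ j) ^ 2 ≤ (1 - a * ε) * m} ∪
      {A | ∃ U : Finset (Fin m), (U.card : ℝ) ≤ β * m ∧
        (1 - a) * ε * m ≤ ∑ i ∈ U, (∑ j, A i j * x₀ j) ^ 2})) := by
    intro A _
    by_contra hA
    simp only [Set.mem_union, Set.mem_ofPred_eq, not_or, not_le, not_exists, not_and] at hA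
    exact hA.1 (mem_omegaEvent_of_forall hm hε0 hε1 hβ hA.2.1 hA.2.2.1 hA.2.2.2)
  have hone : 1 ≤ μ (omegaEvent m n x₀ ε β) + ENNReal.ofReal (3 * p) := by
    have hp3 : ENNReal.ofReal (3 * p) =
        ENNReal.ofReal p + (ENNReal.ofReal p + ENNReal.ofReal p) := by
      rw [← ENNReal.ofReal_add (exp_pos _).le (exp_pos _).le,
        ← ENNReal.ofReal_add (exp_pos _).le (by positivity)]
      congr 1
      ring
    calc 1 = μ Set.univ := measure_univ.symm
      _ ≤ _ := measure_mono hcover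
      _ ≤ _ := (measure_union_le _ _).trans (add_le_add_right ((measure_union_le _ _).trans
          (add_le_add h₁ ((measure_union_le _ _).trans (add_le_add h₂ h₃)))) _)
      _ = _ := by rw [hp3]
  rw [ENNReal.ofReal_sub _ (by positivity), ENNReal.ofReal_one]
  exact tsub_le_iff_right.2 hone

end GaussianMatrix

theorem log_four_div_ge {u : ℝ} (hu0 : 0 < u) (hu1 : u ≤ 1) : 2 * log 2 ≤ log (4 / u) := by
  rw [show 2 * log 2 = log 4 by rw [show (4 : ℝ) = 2 ^ 2 by norm_num, Real.log_pow]; norm_num]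
  exact Real.log_le_log (by norm_num) ((le_div_iff₀ hu0).2 (by linarith))

theorem mul_one_sub_log_half_le {u : ℝ} (hu0 : 0 < u) (hu1 : u ≤ 1) :
    u / (12 * log (4 / u)) * (1 - log (u / (12 * log (4 / u)) / 2)) ≤ 5 / 16 * u := by
  have hL := log_four_div_ge hu0 hu1
  set L := log (4 / u) with hLdef
  have hlog2 := Real.log_two_gt_d9
  have hL0 : 0 < L := by linarith
  have hlog6 : log 6 ≤ 3 * log 2 := by
    rw [show 3 * log 2 = log 8 by rw [show (8 : ℝ) = 2 ^ 3 by norm_num, Real.log_pow]; norm_num]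
    exact Real.log_le_log (by norm_num) (by norm_num)
  have hsplit : log (u / (12 * L) / 2) = -(L + log 6 + log L) := by
    rw [show u / (12 * L) / 2 = (4 / u * 6 * L)⁻¹ by field_simp; norm_num, Real.log_inv,
      Real.log_mul (by positivity) (by positivity), Real.log_mul (by positivity) (by positivity)]
  have hlogL := Real.log_le_sub_one_of_pos hL0
  rw [hsplit, div_mul_eq_mul_div, div_le_iff₀ (by positivity)]
  have : 1 - -(L + log 6 + log L) ≤ 5 / 16 * (12 * L) := by linarith
  calc _ ≤ u * (5 / 16 * (12 * L)) := mul_le_mul_of_nonneg_left this hu0.le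
    _ = _ := by ring

theorem betaMax_lower_bound (n : ℕ) (x₀ : Fin n → ℝ) (hx₀ : ∑ j, x₀ j ^ 2 = 1)
    (α : ℝ) (hα0 : 0 < α) (hα1 : α < 1) :
    (∀ ε : ℝ, 0 < ε → ε ≤ min 1 ((1 - Real.sqrt α) / (4 * α)) →
      ∀ β : ℝ, 0 < β →
        β ≤ (1 - Real.sqrt α) * ε / (16 * Real.log (4 / ((1 - Real.sqrt α) * ε))) →
        ∀ m : ℕ, 0 < m →
          ENNReal.ofReal (1 - 3 * Real.exp (-α * (ε ^ 2 / 4 - ε ^ 3 / 6) * m)) ≤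
            gaussianMatrix m n (omegaEvent m n x₀ ε β)) ∧
    (∀ ε : ℝ, 0 < ε → ε ≤ (1 - Real.sqrt α) / 4 →
      ((1 - Real.sqrt α) / 32) * (ε / Real.log (1 / ε)) < betaMax n x₀ ε α) := by
  have ha0 : 0 < √α := Real.sqrt_pos.2 hα0
  have ha1 : √α < 1 := by rwa [Real.sqrt_lt' one_pos, one_pow]
  have haα : √α ^ 2 = α := Real.sq_sqrt hα0.le
  have key : ∀ ε : ℝ, 0 < ε → ε ≤ 1 → ε ≤ (1 - √α) / (4 * α) → ∀ m : ℕ, 0 < m →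
      ENNReal.ofReal (1 - 3 * Real.exp (-α * (ε ^ 2 / 4 - ε ^ 3 / 6) * m)) ≤
        gaussianMatrix m n (omegaEvent m n x₀ ε
          ((1 - √α) * ε / (12 * Real.log (4 / ((1 - √α) * ε))))) := by
    intro ε hε0 hε1 hεα m hm
    have hu0 : 0 < (1 - √α) * ε := mul_pos (by linarith) hε0
    have hu1 : (1 - √α) * ε ≤ 1 := by nlinarith
    have hL := log_four_div_ge hu0 hu1
    have hlog2 := Real.log_two_gt_d9
    have hβ : (1 - √α) * ε / (12 * Real.log (4 / ((1 - √α) * ε))) ≤ (1 - √α) * ε / 12 :=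
      div_le_div_of_nonneg_left hu0.le (by norm_num) (by linarith)
    have hβ0 : 0 < (1 - √α) * ε / (12 * Real.log (4 / ((1 - √α) * ε))) :=
      div_pos hu0 (by linarith)
    rw [le_div_iff₀ (by positivity)] at hεα
    have h := le_gaussianMatrix_omegaEvent hx₀ hm ha0 ha1 hε0 hε1 hβ0 (by linarith)
      (by nlinarith) (by rw [haα]; linarith) (mul_one_sub_log_half_le hu0 hu1)
    rwa [haα] at h
  have hle : ∀ ε : ℝ, 0 < ε → ε ≤ 1 →
      (1 - √α) * ε / (16 * Real.log (4 / ((1 - √α) * ε))) <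
        (1 - √α) * ε / (12 * Real.log (4 / ((1 - √α) * ε))) := by
    intro ε hε0 hε1
    have hu0 : 0 < (1 - √α) * ε := mul_pos (by linarith) hε0
    have hL := log_four_div_ge hu0 (by nlinarith)
    have hlog2 := Real.log_two_gt_d9
    exact div_lt_div_of_pos_left hu0 (by linarith) (by linarith)
  refine ⟨fun ε hε0 hε β _ hβ m hm => ?_, fun ε hε0 hε => ?_⟩
  · have hε1 := hε.trans (min_le_left _ _)
    exact (key ε hε0 hε1 (hε.trans (min_le_right _ _)) m hm).trans
      (measure_mono (omegaEvent_anti (hβ.trans (hle ε hε0 hε1).le)))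
  · have hε1 : ε ≤ 1 := by linarith
    have hε4 : ε < 1 / 4 := by linarith
    have hεα : ε ≤ (1 - √α) / (4 * α) :=
      hε.trans (div_le_div_of_nonneg_left (by linarith) (by positivity) (by linarith))
    have hu0 : 0 < (1 - √α) * ε := mul_pos (by linarith) hε0
    have hu1 : (1 - √α) * ε ≤ 1 := by nlinarith
    have hL := log_four_div_ge hu0 hu1
    have hlog2 := Real.log_two_gt_d9
    have hlogle : Real.log (4 / ((1 - √α) * ε)) ≤ 2 * Real.log (1 / ε) := by
      rw [show 2 * Real.log (1 / ε) = Real.log ((1 / ε) ^ 2) by rw [Real.log_pow]; norm_num]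
      refine Real.log_le_log (by positivity) ?_
      rw [one_div, inv_pow, ← one_div, div_le_div_iff₀ hu0 (by positivity)]
      nlinarith
    calc (1 - √α) / 32 * (ε / Real.log (1 / ε))
        = (1 - √α) * ε / (16 * (2 * Real.log (1 / ε))) := by ring
      _ ≤ (1 - √α) * ε / (16 * Real.log (4 / ((1 - √α) * ε))) :=
          div_le_div_of_nonneg_left hu0.le (by linarith) (by linarith)
      _ < (1 - √α) * ε / (12 * Real.log (4 / ((1 - √α) * ε))) := hle ε hε0 hε1
      _ ≤ betaMax n x₀ ε α := by
          refine le_csSup ⟨1, fun β hβ => hβ.2.1.le⟩ ⟨?_, ?_, key ε hε0 hε1 hεα⟩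
          · exact (div_pos hu0 (by linarith)).le
          · rw [div_lt_one (by linarith)]
            linarith
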